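/- arXiv:1210.6190 — 5 statements merged into one kernel-verified Lean document; each statement's English description precedes it below -/
import Mathlib

section
/- For every excursion f and all s, t, u, v ∈ [0, τ(f)], the four-point (0-hyperbolicity) inequality holds: d_f(s,t) + d_f(u,v) ≤ max( d_f(s,u) + d_f(t,v), d_f(s,v) + d_f(t,u) ). -/
/-- The infimum of `f` over the interval between `s` and `t`. -/
noncomputable def excursionInf (f : ℝ → ℝ) (s t : ℝ) : ℝ :=
  sInf (f '' Set.Icc (min s t) (max s t))

/-- The excursion pseudo-distance `d_f(s,t) = f(s) + f(t) - 2 m_f(s,t)`. -/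
noncomputable def excursionDist (f : ℝ → ℝ) (s t : ℝ) : ℝ :=
  f s + f t - 2 * excursionInf f s t

theorem excursionInf_comm (f : ℝ → ℝ) (s t : ℝ) : excursionInf f s t = excursionInf f t s := by
  simp only [excursionInf, min_comm, max_comm]

/-- Strong triangle inequality for `excursionInf`. -/
theorem min_excursionInf_le {f : ℝ → ℝ} (hf : ∀ t ∈ Set.Ici (0 : ℝ), 0 ≤ f t) {s t u : ℝ}
    (hs : 0 ≤ s) (ht : 0 ≤ t) (hu : 0 ≤ u) :
    min (excursionInf f s u) (excursionInf f u t) ≤ excursionInf f s t := by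
  have key : ∀ {a b r : ℝ}, 0 ≤ a → 0 ≤ b → r ∈ Set.uIcc a b → excursionInf f a b ≤ f r := by
    intro a b r ha hb hr
    refine csInf_le ⟨0, ?_⟩ ⟨r, hr, rfl⟩
    rintro _ ⟨x, hx, rfl⟩
    exact hf x ((le_min ha hb).trans hx.1)
  refine le_csInf (Set.nonempty_uIcc.image f) ?_
  rintro _ ⟨r, hr, rfl⟩
  rcases Set.uIcc_subset_uIcc_union_uIcc (b := u) hr with h | h
  · exact (min_le_left _ _).trans (key hs hu h)
  · exact (min_le_right _ _).trans (key hu ht h)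

/-- The four-point inequality for a symmetric function satisfying the strong triangle
inequality with `min`. -/
theorem min_add_le_add_of_min_le {α : Type*} {m : α → α → ℝ} {S : Set α}
    (hcomm : ∀ a b, m a b = m b a)
    (hmin : ∀ a ∈ S, ∀ b ∈ S, ∀ c ∈ S, min (m a b) (m b c) ≤ m a c)
    {s t u v : α} (hs : s ∈ S) (ht : t ∈ S) (hu : u ∈ S) (hv : v ∈ S) :
    min (m s u + m t v) (m s v + m t u) ≤ m s t + m u v := by
  have h₁ := hmin s hs u hu t ht
  have h₂ := hmin s hs v hv t ht
  have h₃ := hmin u hu s hs v hv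
  have h₄ := hmin u hu t ht v hv
  rw [hcomm u t] at h₁ h₄
  rw [hcomm v t] at h₂
  rw [hcomm u s] at h₃
  simp only [min_le_iff] at *
  by_contra! h
  rcases h₁ with h₁ | h₁ <;> rcases h₂ with h₂ | h₂ <;> rcases h₃ with h₃ | h₃ <;>
    rcases h₄ with h₄ | h₄ <;> linarith

/-- For every excursion `f` and all `s, t, u, v ∈ [0, τ(f)]`, the four-point
(0-hyperbolicity) inequality holds. -/
theorem excursionDist_four_point
    (f : ℝ → ℝ) (τ : ℝ) (hτ : 0 < τ)
    (hf_cont : ContinuousOn f (Set.Ici 0))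
    (hf_nonneg : ∀ t ∈ Set.Ici (0 : ℝ), 0 ≤ f t)
    (hf_pos : ∀ t ∈ Set.Ici (0 : ℝ), (0 < f t ↔ t ∈ Set.Ioo 0 τ)) :
    ∀ s ∈ Set.Icc (0 : ℝ) τ, ∀ t ∈ Set.Icc (0 : ℝ) τ,
      ∀ u ∈ Set.Icc (0 : ℝ) τ, ∀ v ∈ Set.Icc (0 : ℝ) τ,
      excursionDist f s t + excursionDist f u v ≤
        max (excursionDist f s u + excursionDist f t v)
            (excursionDist f s v + excursionDist f t u) := by
  intro s hs t ht u hu v hv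
  have h := min_add_le_add_of_min_le (S := Set.Ici 0) (excursionInf_comm f)
    (fun _ ha _ hb _ hc => min_excursionInf_le hf_nonneg ha hc hb) hs.1 ht.1 hu.1 hv.1
  simp only [excursionDist, le_max_iff]
  rcases min_le_iff.1 h with h | h
  · left; linarith
  · right; linarith
end

section
/- For every excursion f, the associated tree T_f is a dendrite: there is no map h from the unit circle S¹ ⊆ ℝ² into [0, τ(f)] that is continuous as a map into the pseudometric space ([0, τ(f)], d_f) and satisfies d_f(h(x), h(y)) = 0 if and only if x = y. Equivalently, the metric quotient T_f := [0, τ(f)] / {d_f = 0} contains no subset homeomorphic to the circle. -/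
theorem excursionInf_self (f : ℝ → ℝ) (s : ℝ) : excursionInf f s s = f s := by
  simp [excursionInf]

theorem excursionInf_bddBelow {f : ℝ → ℝ} (hf : ∀ t ∈ Set.Ici (0 : ℝ), 0 ≤ f t) {s t : ℝ}
    (hs : 0 ≤ s) (ht : 0 ≤ t) : BddBelow (f '' Set.Icc (min s t) (max s t)) := by
  refine ⟨0, ?_⟩
  rintro _ ⟨r, hr, rfl⟩
  exact hf r ((le_min hs ht).trans hr.1)

theorem excursionInf_le_left {f : ℝ → ℝ} (hf : ∀ t ∈ Set.Ici (0 : ℝ), 0 ≤ f t) {s t : ℝ}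
    (hs : 0 ≤ s) (ht : 0 ≤ t) : excursionInf f s t ≤ f s :=
  csInf_le (excursionInf_bddBelow hf hs ht) ⟨s, Set.left_mem_uIcc, rfl⟩

theorem excursionInf_le_right {f : ℝ → ℝ} (hf : ∀ t ∈ Set.Ici (0 : ℝ), 0 ≤ f t) {s t : ℝ}
    (hs : 0 ≤ s) (ht : 0 ≤ t) : excursionInf f s t ≤ f t :=
  csInf_le (excursionInf_bddBelow hf hs ht) ⟨t, Set.right_mem_uIcc, rfl⟩

/-- The ultrametric-type inequality for the infimum. -/
theorem min_excursionInf_le_s5 {f : ℝ → ℝ} (hf : ∀ t ∈ Set.Ici (0 : ℝ), 0 ≤ f t) {a b c : ℝ}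
    (ha : 0 ≤ a) (hb : 0 ≤ b) (hc : 0 ≤ c) :
    min (excursionInf f a c) (excursionInf f c b) ≤ excursionInf f a b := by
  refine le_csInf ⟨f a, a, Set.left_mem_uIcc, rfl⟩ ?_
  rintro _ ⟨r, hr, rfl⟩
  have hr' : r ∈ Set.uIcc a b := hr
  rcases Set.uIcc_subset_uIcc_union_uIcc (b := c) hr' with h | h
  · exact (min_le_left _ _).trans (csInf_le (excursionInf_bddBelow hf ha hc) ⟨r, h, rfl⟩)
  · exact (min_le_right _ _).trans (csInf_le (excursionInf_bddBelow hf hc hb) ⟨r, h, rfl⟩)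

theorem isPreconnected_compl_singleton_sphere {E : Type*} [NormedAddCommGroup E]
    [InnerProductSpace ℝ E] (v : Metric.sphere (0 : E) 1) :
    IsPreconnected ({v}ᶜ : Set (Metric.sphere (0 : E) 1)) := by
  have hv : ‖(v : E)‖ = 1 := norm_eq_of_mem_sphere v
  let e := stereographic hv
  have hs : e.source = {v}ᶜ := stereographic_source hv
  have ht : e.target = Set.univ := stereographic_target hv
  rw [← hs, ← e.symm_image_target_eq_source]
  refine IsPreconnected.image ?_ _ e.continuousOn_symm
  rw [ht]
  exact isPreconnected_univ

/-- A subset of the circle with at most one point has preconnected complement. -/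
theorem isPreconnected_compl_of_subsingleton_circle
    {P : Set (Metric.sphere (0 : EuclideanSpace ℝ (Fin 2)) 1)} (hP : P.Subsingleton) :
    IsPreconnected Pᶜ := by
  rcases hP.eq_empty_or_singleton with rfl | ⟨v, rfl⟩
  · have hr : 1 < Module.rank ℝ (EuclideanSpace ℝ (Fin 2)) := by
      rw [← Module.finrank_eq_rank, finrank_euclideanSpace_fin]
      norm_num
    rw [Set.compl_empty]
    have := Subtype.preconnectedSpace (isPreconnected_sphere hr 0 1)
    exact isPreconnected_univ
  · exact isPreconnected_compl_singleton_sphere v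

/-- If no subset with at most one point disconnects `X`, then along a map from `X` that is continuous
and injective for the excursion pseudo-distance, the value of `f` at any point is at most its infimum
between that point and any other one. -/
theorem le_excursionInf_of_injective {X : Type*} [PseudoMetricSpace X]
    (hX : ∀ P : Set X, P.Subsingleton → IsPreconnected Pᶜ)
    {f : ℝ → ℝ} (hf : ∀ t ∈ Set.Ici (0 : ℝ), 0 ≤ f t) {h : X → ℝ} (h0 : ∀ x, 0 ≤ h x)
    (hcont : ∀ x, ∀ ε > (0 : ℝ), ∃ δ > (0 : ℝ), ∀ y,
      dist x y < δ → excursionDist f (h x) (h y) < ε)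
    (hinj : ∀ x y, excursionDist f (h x) (h y) = 0 → x = y) (a b : X) :
    f (h a) ≤ excursionInf f (h a) (h b) := by
  by_contra! hlt
  obtain ⟨l, hml, hlf⟩ := exists_between hlt
  have hL (x y : X) := excursionInf_le_left hf (h0 x) (h0 y)
  have hR (x y : X) := excursionInf_le_right hf (h0 x) (h0 y)
  have hU (x y z : X) := min_le_iff.mp (min_excursionInf_le_s5 hf (h0 x) (h0 y) (h0 z))
  let φ : X → ℝ := fun x => excursionInf f (h a) (h x)
  let P : Set X := {x | φ x = l ∧ f (h x) = l}
  let U : Set X := {x | l < φ x}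
  let V : Set X := {x | φ x ≤ l ∧ x ∉ P}
  have hP : P.Subsingleton := by
    rintro x ⟨hx, hx'⟩ y ⟨hy, hy'⟩
    apply hinj
    have h1 := hU x y a
    rw [excursionInf_comm f (h x) (h a)] at h1
    have h2 := hL x y
    simp only [excursionDist]
    simp only [φ] at hx hy
    rcases h1 with h1 | h1 <;> linarith
  have hUo : IsOpen U := by
    refine Metric.isOpen_iff.mpr fun x (hx : l < φ x) => ?_
    obtain ⟨δ, hδ, H⟩ := hcont x (f (h x) - l) (by linarith [hR a x])
    refine ⟨δ, hδ, fun y hy => ?_⟩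
    have h1 := H y (by rwa [dist_comm])
    have h2 := hR x y
    simp only [excursionDist] at h1
    change l < excursionInf f (h a) (h y)
    change l < excursionInf f (h a) (h x) at hx
    rcases hU a y x with h3 | h3 <;> linarith
  have hVo : IsOpen V := by
    refine Metric.isOpen_iff.mpr fun x hx => ?_
    obtain ⟨hx : excursionInf f (h a) (h x) ≤ l, hxP⟩ := hx
    have near (ε : ℝ) (hε : 0 < ε) : ∃ δ > 0, ∀ y ∈ Metric.ball x δ,
        f (h x) - ε < excursionInf f (h x) (h y) ∧ f (h y) < f (h x) + ε ∧
        (excursionInf f (h a) (h y) ≤ excursionInf f (h a) (h x) ∨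
          excursionInf f (h x) (h y) ≤ excursionInf f (h a) (h x)) := by
      obtain ⟨δ, hδ, H⟩ := hcont x ε hε
      refine ⟨δ, hδ, fun y hy => ?_⟩
      have h1 := H y (by rwa [dist_comm])
      simp only [excursionDist] at h1
      have h4 := hU a x y
      rw [excursionInf_comm f (h y) (h x)] at h4
      exact ⟨by linarith [hR x y], by linarith [hL x y], h4⟩
    rcases lt_trichotomy (f (h x)) l with hlt | heq | hgt
    · obtain ⟨δ, hδ, H⟩ := near (l - f (h x)) (by linarith)
      refine ⟨δ, hδ, fun y hy => ?_⟩
      obtain ⟨-, h2, -⟩ := H y hy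
      exact ⟨show excursionInf f (h a) (h y) ≤ l by linarith [hR a y],
        fun hy => by linarith [hy.2]⟩
    · have hne : excursionInf f (h a) (h x) < l := lt_of_le_of_ne hx fun hx' => hxP ⟨hx', heq⟩
      obtain ⟨δ, hδ, H⟩ := near (l - excursionInf f (h a) (h x)) (by linarith)
      refine ⟨δ, hδ, fun y hy => ?_⟩
      obtain ⟨h1, -, h3⟩ := H y hy
      have h4 : excursionInf f (h a) (h y) < l := by rcases h3 with h3 | h3 <;> linarith
      exact ⟨h4.le, fun hy => h4.ne hy.1⟩
    · obtain ⟨δ, hδ, H⟩ := near (f (h x) - l) (by linarith)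
      refine ⟨δ, hδ, fun y hy => ?_⟩
      obtain ⟨h1, -, h3⟩ := H y hy
      have h4 : excursionInf f (h a) (h y) ≤ l := by rcases h3 with h3 | h3 <;> linarith
      exact ⟨h4, fun hy => by linarith [hy.2, hR x y]⟩
  have hφa : φ a = f (h a) := excursionInf_self f (h a)
  have haP : a ∉ P := fun ha => hlf.ne' ha.2
  have hbP : b ∉ P := fun hb => hml.ne hb.1
  obtain ⟨x, -, hx, hx'⟩ := hX P hP U V hUo hVo
    (fun x hx => (lt_or_ge l (φ x)).imp id fun h => ⟨h, hx⟩)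
    ⟨a, haP, hlf.trans_eq hφa.symm⟩ ⟨b, hbP, hml.le, hbP⟩
  exact hx.not_ge hx'.1

/-- For every excursion `f`, the associated tree `T_f` is a dendrite: there is no
injective (up to `d_f`-distance zero) continuous map from the unit circle `S¹ ⊆ ℝ²`
into the pseudometric space `([0, τ(f)], d_f)`. -/
theorem excursion_tree_no_circle
    (f : ℝ → ℝ) (τ : ℝ) (hτ : 0 < τ)
    (hf_cont : ContinuousOn f (Set.Ici 0))
    (hf_nonneg : ∀ t ∈ Set.Ici (0 : ℝ), 0 ≤ f t)
    (hf_pos : ∀ t ∈ Set.Ici (0 : ℝ), (0 < f t ↔ t ∈ Set.Ioo 0 τ)) :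
    ¬ ∃ h : Metric.sphere (0 : EuclideanSpace ℝ (Fin 2)) 1 → ℝ,
        (∀ x, h x ∈ Set.Icc (0 : ℝ) τ) ∧
        (∀ x, ∀ ε > (0 : ℝ), ∃ δ > (0 : ℝ), ∀ y,
          dist x y < δ → excursionDist f (h x) (h y) < ε) ∧
        (∀ x y, excursionDist f (h x) (h y) = 0 ↔ x = y) := by
  rintro ⟨h, hmem, hcont, hinj⟩
  have key := le_excursionInf_of_injective
    (fun _ => isPreconnected_compl_of_subsingleton_circle) hf_nonneg (fun x => (hmem x).1) hcont
    (fun x y => (hinj x y).1)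
  have hv : EuclideanSpace.single (0 : Fin 2) (1 : ℝ) ∈
      Metric.sphere (0 : EuclideanSpace ℝ (Fin 2)) 1 := by simp
  let a : Metric.sphere (0 : EuclideanSpace ℝ (Fin 2)) 1 := ⟨_, hv⟩
  have h1 := key a (-a)
  have h2 := key (-a) a
  rw [excursionInf_comm] at h2
  have h3 := excursionInf_le_left hf_nonneg (hmem a).1 (hmem (-a)).1
  have h4 := excursionInf_le_right hf_nonneg (hmem a).1 (hmem (-a)).1
  have h5 : a = -a := (hinj a (-a)).1 (by simp only [excursionDist]; linarith)
  exact ne_neg_of_mem_unit_sphere ℝ a h5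
end

section
/- For all distinct a, b ∈ {1,2,3}, the intersection F_a(T) ∩ F_b(T) equals the singleton {(1/2, 0)}. -/
/-- The three contractions defining the self-similar dendrite. Letters `0, 1, 2` of
`Fin 3` stand for the letters `1, 2, 3` of the alphabet `{1,2,3}`. -/
noncomputable def Fmap (c : ℝ) (a : Fin 3) (p : ℝ × ℝ) : ℝ × ℝ :=
  if a = 0 then ((1 - p.1) / 2, p.2 / 2)
  else if a = 1 then ((1 + p.1) / 2, -p.2 / 2)
  else (1 / 2 + c * p.2, c * p.1)

/-- A continuous function on a compact set whose positive upper bounds can be halved is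
nonpositive there. -/
lemma IsCompact.forall_nonpos_of_halving {X : Type*} [TopologicalSpace X] {s : Set X}
    (hs : IsCompact s) {g : X → ℝ} (hg : Continuous g)
    (h : ∀ M, 0 < M → (∀ p ∈ s, g p ≤ M) → ∀ p ∈ s, g p ≤ M / 2) :
    ∀ p ∈ s, g p ≤ 0 := by
  intro p hp
  obtain ⟨q, hq, hmax⟩ := hs.exists_isMaxOn ⟨p, hp⟩ hg.continuousOn
  by_contra! hpos
  have hM : 0 < g q := hpos.trans_le (hmax hp)
  linarith [h (g q) hM (fun r hr => hmax hr) q hq]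

/-- The attractor lies in the rhombus with vertices `(0, 0)`, `(1, 0)`, `(1/2, ±c)`. -/
lemma attractor_subset_rhombus {c : ℝ} (hc : c ∈ Set.Ioo (0 : ℝ) (1 / 2))
    {T : Set (ℝ × ℝ)} (hcomp : IsCompact T)
    (hattr : T = Fmap c 0 '' T ∪ Fmap c 1 '' T ∪ Fmap c 2 '' T) :
    ∀ p ∈ T, |p.2| ≤ 2 * c * p.1 ∧ |p.2| ≤ 2 * c * (1 - p.1) := by
  obtain ⟨hc0, hc1⟩ := hc
  have key : ∀ p ∈ T,
      max (|p.2| - 2 * c * p.1) (|p.2| - 2 * c * (1 - p.1)) ≤ 0 := by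
    refine hcomp.forall_nonpos_of_halving (by fun_prop) ?_
    intro M hM hT p hp
    rw [hattr] at hp
    rcases hp with (⟨⟨x, y⟩, hq, rfl⟩ | ⟨⟨x, y⟩, hq, rfl⟩) | ⟨⟨x, y⟩, hq, rfl⟩
    · have hq' := hT _ hq
      simp only [max_le_iff] at hq'
      simp only [Fmap, if_true, max_le_iff, abs_div, abs_two]
      constructor <;> linarith [hq'.1, hq'.2]
    · have hq' := hT _ hq
      simp only [max_le_iff] at hq'
      simp only [Fmap, one_ne_zero, if_false, if_true, max_le_iff, abs_div, abs_neg, abs_two]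
      constructor <;> linarith [hq'.1, hq'.2]
    · have hq' := hT _ hq
      simp only [max_le_iff] at hq'
      obtain ⟨h0, h1⟩ := hq'
      have hx0 : 0 ≤ M + 2 * c * x := by linarith [abs_nonneg y]
      have hx1 : 0 ≤ M + 2 * c * (1 - x) := by linarith [abs_nonneg y]
      have hc2 : 0 ≤ 1 - 4 * c ^ 2 := by nlinarith
      have hcc : 0 < c ^ 2 := by positivity
      have hcx : |c * x| ≤ M / 2 + c - 2 * c ^ 2 * |y| := by
        rw [abs_le]
        constructor <;>
          nlinarith [mul_le_mul_of_nonneg_left h0 hcc.le, mul_le_mul_of_nonneg_left h1 hcc.le,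
            mul_nonneg hc2 hx0, mul_nonneg hc2 hx1]
      have hy := mul_le_mul_of_nonneg_left (neg_abs_le y) hcc.le
      have hy' := mul_le_mul_of_nonneg_left (le_abs_self y) hcc.le
      simp only [Fmap, Fin.reduceEq, if_false, max_le_iff]
      constructor <;> nlinarith
  intro p hp
  have h := max_le_iff.1 (key p hp)
  exact ⟨by linarith [h.1], by linarith [h.2]⟩

/-- The fixed point `(1, 0)` of `Fmap c 1` lies in every nonempty compact set that `Fmap c 1`
maps into itself. -/
lemma one_zero_mem_of_mapsTo {c : ℝ} {T : Set (ℝ × ℝ)} (hne : T.Nonempty)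
    (hcomp : IsCompact T) (hT : Set.MapsTo (Fmap c 1) T T) : ((1 : ℝ), (0 : ℝ)) ∈ T := by
  have hg : Continuous fun p : ℝ × ℝ => |1 - p.1| + |p.2| := by fun_prop
  obtain ⟨⟨x, y⟩, hq, hmin⟩ := hcomp.exists_isMinOn hne hg.continuousOn
  have h : |1 - x| + |y| ≤ |1 - (1 + x) / 2| + |-y / 2| := by
    simpa [Fmap] using hmin (hT hq)
  rw [show 1 - (1 + x) / 2 = (1 - x) / 2 by ring, abs_div, abs_div, abs_neg, abs_two] at h
  have hx : 1 - x = 0 := abs_eq_zero.1 (by linarith [abs_nonneg (1 - x), abs_nonneg y])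
  have hy : y = 0 := abs_eq_zero.1 (by linarith [abs_nonneg (1 - x), abs_nonneg y])
  obtain rfl : x = 1 := by linarith
  rwa [hy] at hq

/-- If `|y| ≤ 2cx`, `|y'| ≤ 2cx'`, `x = 2c|y'|` and `|y| = 2cx'`, with `0 < c < 1/2`, then all
coordinates vanish; only `x' = y' = 0` is recorded. -/
lemma eq_zero_of_cone_of_swapped_cone {c x y x' y' : ℝ} (hc : c ∈ Set.Ioo (0 : ℝ) (1 / 2))
    (h : |y| ≤ 2 * c * x) (h' : |y'| ≤ 2 * c * x')
    (hx : x = 2 * c * |y'|) (hy : |y| = 2 * c * x') : x' = 0 ∧ y' = 0 := by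
  obtain ⟨hc0, hc1⟩ := hc
  have hx' : 0 ≤ x' := by nlinarith [abs_nonneg y]
  have hle : x' ≤ x := le_of_mul_le_mul_left (hy ▸ h) (by positivity : 0 < 2 * c)
  have hxle : x ≤ 4 * c ^ 2 * x' := by
    rw [hx]; nlinarith
  have h0 : x' = 0 := by
    have : 0 < 1 - 4 * c ^ 2 := by nlinarith
    nlinarith
  refine ⟨h0, abs_eq_zero.1 (le_antisymm ?_ (abs_nonneg _))⟩
  simpa [h0] using h'

/-- For distinct letters `a, b ∈ {1,2,3}`, `F_a(T) ∩ F_b(T) = {(1/2, 0)}`. -/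
theorem image_inter_image_eq_singleton (c : ℝ) (hc : c ∈ Set.Ioo (0 : ℝ) (1 / 2))
    (T : Set (ℝ × ℝ)) (hne : T.Nonempty) (hcomp : IsCompact T)
    (hattr : T = Fmap c 0 '' T ∪ Fmap c 1 '' T ∪ Fmap c 2 '' T) :
    ∀ a b : Fin 3, a ≠ b →
      (Fmap c a '' T) ∩ (Fmap c b '' T) = {((1 / 2 : ℝ), (0 : ℝ))} := by
  have hK := attractor_subset_rhombus hc hcomp hattr
  have hc0 : 0 < c := hc.1
  have hnn : ∀ p ∈ T, 0 ≤ p.1 := fun p hp =>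
    nonneg_of_mul_nonneg_right ((abs_nonneg _).trans (hK p hp).1) (by positivity : 0 < 2 * c)
  have h10 : ((1 : ℝ), (0 : ℝ)) ∈ T := one_zero_mem_of_mapsTo (c := c) hne hcomp fun p hp => by
    rw [hattr]
    exact Or.inl (Or.inr ⟨p, hp, rfl⟩)
  have h00 : ((0 : ℝ), (0 : ℝ)) ∈ T := by
    rw [hattr]
    exact Or.inl (Or.inl ⟨_, h10, by simp [Fmap]⟩)
  have hmem : ∀ a, ((1 / 2 : ℝ), (0 : ℝ)) ∈ Fmap c a '' T := fun a =>
    ⟨_, h00, by fin_cases a <;> simp [Fmap]⟩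
  have h01 : Fmap c 0 '' T ∩ Fmap c 1 '' T ⊆ {((1 / 2 : ℝ), (0 : ℝ))} := by
    rintro _ ⟨⟨⟨x, y⟩, hp, rfl⟩, ⟨⟨x', y'⟩, hq, h⟩⟩
    simp only [Fmap, one_ne_zero, if_false, if_true, Prod.mk.injEq] at h
    have hx : 0 ≤ x := hnn _ hp
    have hx' : 0 ≤ x' := hnn _ hq
    obtain rfl : x = 0 := by linarith [h.1]
    obtain rfl : y = 0 := by simpa using (hK _ hp).1
    simp [Fmap]
  have h02 : Fmap c 0 '' T ∩ Fmap c 2 '' T ⊆ {((1 / 2 : ℝ), (0 : ℝ))} := by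
    rintro _ ⟨⟨⟨x, y⟩, hp, h⟩, ⟨⟨x', y'⟩, hq, rfl⟩⟩
    simp only [Fmap, Fin.reduceEq, if_false, if_true, Prod.mk.injEq] at h
    have hx : 0 ≤ x := hnn _ hp
    have hx' : 0 ≤ x' := hnn _ hq
    obtain ⟨rfl, rfl⟩ := eq_zero_of_cone_of_swapped_cone hc (hK _ hp).1 (hK _ hq).1
      (by rw [abs_of_nonpos (by nlinarith [h.1] : y' ≤ 0)]; linarith [h.1])
      (by rw [show y = 2 * c * x' by linarith [h.2], abs_of_nonneg (by positivity)])
    simp [Fmap]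
  have h12 : Fmap c 1 '' T ∩ Fmap c 2 '' T ⊆ {((1 / 2 : ℝ), (0 : ℝ))} := by
    rintro _ ⟨⟨⟨x, y⟩, hp, h⟩, ⟨⟨x', y'⟩, hq, rfl⟩⟩
    simp only [Fmap, Fin.reduceEq, one_ne_zero, if_false, if_true, Prod.mk.injEq] at h
    have hx : 0 ≤ x := hnn _ hp
    have hx' : 0 ≤ x' := hnn _ hq
    obtain ⟨rfl, rfl⟩ := eq_zero_of_cone_of_swapped_cone hc (hK _ hp).1 (hK _ hq).1
      (by rw [abs_of_nonneg (by nlinarith [h.1] : 0 ≤ y')]; linarith [h.1])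
      (by rw [show y = -(2 * c * x') by linarith [h.2], abs_neg, abs_of_nonneg (by positivity)])
    simp [Fmap]
  intro a b hab
  refine Set.Subset.antisymm ?_ (Set.singleton_subset_iff.2 ⟨hmem a, hmem b⟩)
  fin_cases a <;> fin_cases b
  · exact absurd rfl hab
  · exact h01
  · exact h02
  · exact Set.inter_comm _ _ ▸ h01
  · exact absurd rfl hab
  · exact h12
  · exact Set.inter_comm _ _ ▸ h02
  · exact Set.inter_comm _ _ ▸ h12
  · exact absurd rfl hab
end

section
/- For all distinct infinite words i, j ∈ Σ: π_T(i) = π_T(j) if and only if there exist a finite word k over {1,2,3} and distinct letters a, b ∈ {1,2,3} such that i = k a 1 2 2 2 … and j = k b 1 2 2 2 … (that is, i begins with the prefix ka1 and all its subsequent letters are 2, and j begins with the prefix kb1 and all its subsequent letters are 2). -/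
/-- For a finite word `i = i₁…iₙ`, `Fword c i = F_{i₁} ∘ ⋯ ∘ F_{iₙ}`. -/
noncomputable def Fword (c : ℝ) : List (Fin 3) → ℝ × ℝ → ℝ × ℝ
  | [] => id
  | a :: w => Fmap c a ∘ Fword c w

/-- Concatenation of a finite word `w` with an infinite word `j`. -/
def wordAppend (w : List (Fin 3)) (j : ℕ → Fin 3) : ℕ → Fin 3 :=
  fun n => if h : n < w.length then w.get ⟨n, h⟩ else j (n - w.length)

/-- The diamond with diagonal from `(0, 0)` to `(1, 0)` and sides of slope `±2c`. -/
def diamond (c : ℝ) : Set (ℝ × ℝ) :=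
  {p | |p.2| ≤ 2 * c * p.1 ∧ |p.2| ≤ 2 * c * (1 - p.1)}

lemma isClosed_diamond (c : ℝ) : IsClosed (diamond c) := by
  exact (isClosed_le (f := fun p : ℝ × ℝ => |p.2|) (g := fun p => 2 * c * p.1)
    (by fun_prop) (by fun_prop)).inter
    (isClosed_le (f := fun p : ℝ × ℝ => |p.2|) (g := fun p => 2 * c * (1 - p.1))
    (by fun_prop) (by fun_prop))

@[simp] lemma Fmap_zero (c : ℝ) (p : ℝ × ℝ) : Fmap c 0 p = ((1 - p.1) / 2, p.2 / 2) := rfl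

@[simp] lemma Fmap_one (c : ℝ) (p : ℝ × ℝ) : Fmap c 1 p = ((1 + p.1) / 2, -p.2 / 2) := rfl

@[simp] lemma Fmap_two (c : ℝ) (p : ℝ × ℝ) : Fmap c 2 p = (1 / 2 + c * p.2, c * p.1) := rfl

lemma dist_Fmap_le {c : ℝ} (hc : c ∈ Set.Ioo (0 : ℝ) (1 / 2)) (a : Fin 3) (p q : ℝ × ℝ) :
    dist (Fmap c a p) (Fmap c a q) ≤ 1 / 2 * dist p q := by
  obtain ⟨h0, h1⟩ := hc
  have hx : |p.1 - q.1| ≤ dist p q := by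
    rw [← Real.dist_eq, Prod.dist_eq]; exact le_max_left _ _
  have hy : |p.2 - q.2| ≤ dist p q := by
    rw [← Real.dist_eq, Prod.dist_eq]; exact le_max_right _ _
  rw [abs_le] at hx hy
  rw [Prod.dist_eq, Real.dist_eq, Real.dist_eq]
  fin_cases a <;> simp [abs_le] <;> refine ⟨⟨?_, ?_⟩, ?_, ?_⟩ <;> nlinarith

lemma dist_Fword_le {c : ℝ} (hc : c ∈ Set.Ioo (0 : ℝ) (1 / 2)) (w : List (Fin 3)) (p q : ℝ × ℝ) :
    dist (Fword c w p) (Fword c w q) ≤ (1 / 2) ^ w.length * dist p q := by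
  induction w with
  | nil => simp [Fword]
  | cons a w ih =>
    calc dist (Fmap c a (Fword c w p)) (Fmap c a (Fword c w q))
        ≤ 1 / 2 * dist (Fword c w p) (Fword c w q) := dist_Fmap_le hc a _ _
      _ ≤ 1 / 2 * ((1 / 2) ^ w.length * dist p q) := by gcongr
      _ = (1 / 2) ^ (a :: w).length * dist p q := by rw [List.length_cons, pow_succ]; ring

lemma Fmap_injective {c : ℝ} (hc : c ∈ Set.Ioo (0 : ℝ) (1 / 2)) (a : Fin 3) :
    Function.Injective (Fmap c a) := by
  have h0 := hc.1.ne'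
  rintro ⟨x, y⟩ ⟨x', y'⟩ h
  fin_cases a
  · simp at h
    ext <;> grind
  · simp at h
    ext <;> grind
  · simp [h0] at h
    ext <;> grind

lemma fst_mem_of_mem_diamond {c : ℝ} (hc : c ∈ Set.Ioo (0 : ℝ) (1 / 2)) {p : ℝ × ℝ}
    (hp : p ∈ diamond c) : 0 ≤ p.1 ∧ p.1 ≤ 1 := by
  obtain ⟨h0, h1⟩ := hc
  obtain ⟨h2, h3⟩ := hp
  have := abs_nonneg p.2
  constructor <;> by_contra! h <;> nlinarith

lemma Fmap_mem_diamond {c : ℝ} (hc : c ∈ Set.Ioo (0 : ℝ) (1 / 2)) (a : Fin 3) {p : ℝ × ℝ}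
    (hp : p ∈ diamond c) : Fmap c a p ∈ diamond c := by
  obtain ⟨hx0, hx1⟩ := fst_mem_of_mem_diamond hc hp
  obtain ⟨h0, h1⟩ := hc
  obtain ⟨h2, h3⟩ := hp
  rw [abs_le] at h2 h3
  have hy1 : 2 * c * p.2 ≤ 1 - p.1 := by nlinarith
  have hy2 : -(1 - p.1) ≤ 2 * c * p.2 := by nlinarith
  fin_cases a <;> simp [diamond, abs_le] <;> refine ⟨⟨?_, ?_⟩, ?_, ?_⟩ <;> nlinarith

lemma subset_of_attractor {c : ℝ} (hc : c ∈ Set.Ioo (0 : ℝ) (1 / 2)) {T : Set (ℝ × ℝ)}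
    (hne : T.Nonempty) (hcomp : IsCompact T)
    (hattr : T = Fmap c 0 '' T ∪ Fmap c 1 '' T ∪ Fmap c 2 '' T) : T ⊆ diamond c := by
  have hK : (diamond c).Nonempty := ⟨(0, 0), by simp [diamond, hc.1.le]⟩
  obtain ⟨p, hp, hmax⟩ := hcomp.exists_isMaxOn hne
    (Metric.continuous_infDist_pt (diamond c)).continuousOn
  have hpre : ∃ a, ∃ q ∈ T, Fmap c a q = p := by
    rw [hattr] at hp
    rcases hp with (⟨q, hq, h⟩ | ⟨q, hq, h⟩) | ⟨q, hq, h⟩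
    exacts [⟨_, q, hq, h⟩, ⟨_, q, hq, h⟩, ⟨_, q, hq, h⟩]
  obtain ⟨a, q, hq, rfl⟩ := hpre
  obtain ⟨r, hr, hqr⟩ := (isClosed_diamond c).exists_infDist_eq_dist hK q
  have hle : Metric.infDist (Fmap c a q) (diamond c) ≤ 1 / 2 * dist q r :=
    (Metric.infDist_le_dist_of_mem (Fmap_mem_diamond hc a hr)).trans (dist_Fmap_le hc a q r)
  have hq' : Metric.infDist q (diamond c) ≤ Metric.infDist (Fmap c a q) (diamond c) := hmax hq
  intro x hx
  have hx' : Metric.infDist x (diamond c) ≤ Metric.infDist (Fmap c a q) (diamond c) := hmax hx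
  rw [(isClosed_diamond c).mem_iff_infDist_zero hK]
  have := Metric.infDist_nonneg (x := x) (s := diamond c)
  have := Metric.infDist_nonneg (x := q) (s := diamond c)
  linarith

lemma eq_zero_of_Fmap_eq {c : ℝ} (hc : c ∈ Set.Ioo (0 : ℝ) (1 / 2)) {a b : Fin 3} (hab : a ≠ b)
    {p q : ℝ × ℝ} (hp : p ∈ diamond c) (hq : q ∈ diamond c) (h : Fmap c a p = Fmap c b q) :
    p = (0, 0) := by
  obtain ⟨hx0, hx1⟩ := fst_mem_of_mem_diamond hc hp
  obtain ⟨hx0', hx1'⟩ := fst_mem_of_mem_diamond hc hq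
  obtain ⟨h0, h1⟩ := hc
  obtain ⟨hp, -⟩ := hp
  obtain ⟨hq, -⟩ := hq
  obtain ⟨x, y⟩ := p
  obtain ⟨x', y'⟩ := q
  rw [abs_le] at hp hq
  have key : x = 0 → (x, y) = ((0 : ℝ), (0 : ℝ)) := by
    rintro rfl
    ext <;> grind
  apply key
  fin_cases a <;> fin_cases b <;> simp [Prod.ext_iff] at h hab hp hq hx0 hx1 hx0' hx1' <;>
    obtain ⟨h, h'⟩ := h <;> try nlinarith
  all_goals
    have hle : x ≤ x' := le_of_mul_le_mul_left (by linarith) (by linarith : 0 < 2 * c)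
    have hge : x' ≤ 2 * c * (2 * c * x) := by nlinarith
    have hc1 : 2 * c * (2 * c) < 1 := by nlinarith
    nlinarith

lemma of_Fmap_eq_zero {c : ℝ} (hc : c ∈ Set.Ioo (0 : ℝ) (1 / 2)) {a : Fin 3}
    {p : ℝ × ℝ} (hp : p ∈ diamond c) (h : Fmap c a p = (0, 0)) : a = 0 ∧ p = (1, 0) := by
  obtain ⟨hx0, hx1⟩ := fst_mem_of_mem_diamond hc hp
  obtain ⟨h0, h1⟩ := hc
  obtain ⟨h2, h3⟩ := hp
  rw [abs_le] at h2 h3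
  fin_cases a <;> simp at h <;> obtain ⟨h, h'⟩ := h
  · exact ⟨rfl, Prod.ext (by grind) h'⟩
  · linarith
  · nlinarith

lemma of_Fmap_eq_one {c : ℝ} (hc : c ∈ Set.Ioo (0 : ℝ) (1 / 2)) {a : Fin 3}
    {p : ℝ × ℝ} (hp : p ∈ diamond c) (h : Fmap c a p = (1, 0)) : a = 1 ∧ p = (1, 0) := by
  obtain ⟨hx0, hx1⟩ := fst_mem_of_mem_diamond hc hp
  obtain ⟨h0, h1⟩ := hc
  obtain ⟨h2, h3⟩ := hp
  rw [abs_le] at h2 h3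
  fin_cases a <;> simp at h <;> obtain ⟨h, h'⟩ := h
  · linarith
  · exact ⟨rfl, Prod.ext (by grind) h'⟩
  · nlinarith

/-- The infinite word with its first letter removed. -/
def wordTail (i : ℕ → Fin 3) : ℕ → Fin 3 := fun n => i (n + 1)

@[simp] lemma wordAppend_nil (j : ℕ → Fin 3) : wordAppend [] j = j := by
  funext n; simp [wordAppend]

@[simp] lemma wordAppend_cons_zero (a : Fin 3) (w : List (Fin 3)) (j : ℕ → Fin 3) :
    wordAppend (a :: w) j 0 = a := by
  simp [wordAppend]

@[simp] lemma wordTail_wordAppend_cons (a : Fin 3) (w : List (Fin 3)) (j : ℕ → Fin 3) :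
    wordTail (wordAppend (a :: w) j) = wordAppend w j := by
  funext n
  simp [wordTail, wordAppend]

lemma eq_wordAppend_cons_iff {i j : ℕ → Fin 3} {a : Fin 3} {w : List (Fin 3)} :
    i = wordAppend (a :: w) j ↔ i 0 = a ∧ wordTail i = wordAppend w j := by
  constructor
  · rintro rfl
    simp
  · rintro ⟨h0, h⟩
    funext n
    cases n with
    | zero => simp [h0]
    | succ n =>
      rw [← wordTail_wordAppend_cons a w j] at h
      exact congrFun h n

lemma exists_eq_wordAppend (n : ℕ) (i : ℕ → Fin 3) :
    ∃ (w : List (Fin 3)) (j : ℕ → Fin 3), w.length = n ∧ i = wordAppend w j := by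
  induction n generalizing i with
  | zero => exact ⟨[], i, rfl, (wordAppend_nil i).symm⟩
  | succ n ih =>
    obtain ⟨w, j, hw, h⟩ := ih (wordTail i)
    exact ⟨i 0 :: w, j, by simp [hw], eq_wordAppend_cons_iff.2 ⟨rfl, h⟩⟩

/-- The coding map of a bounded attractor intertwines the shift with the contractions. -/
lemma coding_eq_Fmap {c : ℝ} (hc : c ∈ Set.Ioo (0 : ℝ) (1 / 2)) {T : Set (ℝ × ℝ)}
    (hT : Bornology.IsBounded T) {π : (ℕ → Fin 3) → ℝ × ℝ}
    (hπ : ∀ w : List (Fin 3), π '' Set.range (wordAppend w) = Fword c w '' T) (i : ℕ → Fin 3) :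
    π i = Fmap c (i 0) (π (wordTail i)) := by
  have hmem (w : List (Fin 3)) (j : ℕ → Fin 3) : π (wordAppend w j) ∈ Fword c w '' T :=
    hπ w ▸ Set.mem_image_of_mem π (Set.mem_range_self j)
  have hdist (n : ℕ) : dist (π i) (Fmap c (i 0) (π (wordTail i))) ≤
      (1 / 2) ^ n * Metric.diam T := by
    obtain ⟨w, j, hw, h⟩ := exists_eq_wordAppend n (wordTail i)
    have hi : i = wordAppend (i 0 :: w) j := eq_wordAppend_cons_iff.2 ⟨rfl, h⟩
    obtain ⟨p, hp, hpe⟩ := hmem (i 0 :: w) j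
    obtain ⟨q, hq, hqe⟩ := hmem w j
    rw [← hi] at hpe
    rw [h, ← hqe, ← hpe]
    calc dist (Fword c (i 0 :: w) p) (Fword c (i 0 :: w) q)
        ≤ (1 / 2) ^ (i 0 :: w).length * dist p q := dist_Fword_le hc _ p q
      _ ≤ (1 / 2) ^ n * Metric.diam T := by
        refine mul_le_mul ?_ (Metric.dist_le_diam_of_mem hT hp hq) dist_nonneg (by positivity)
        exact pow_le_pow_of_le_one (by norm_num) (by norm_num) (by simp [hw])
  have hlim : Filter.Tendsto (fun n : ℕ => (1 / 2 : ℝ) ^ n * Metric.diam T)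
      Filter.atTop (nhds 0) := by
    simpa using (tendsto_pow_atTop_nhds_zero_of_lt_one (r := (1 / 2 : ℝ))
      (by norm_num) (by norm_num)).mul_const (Metric.diam T)
  exact dist_le_zero.1 (ge_of_tendsto' hlim hdist)

section Coding

variable {c : ℝ} {π : (ℕ → Fin 3) → ℝ × ℝ}

lemma coding_wordAppend (hfun : ∀ i, π i = Fmap c (i 0) (π (wordTail i)))
    (w : List (Fin 3)) (j : ℕ → Fin 3) : π (wordAppend w j) = Fword c w (π j) := by
  induction w with
  | nil => simp [Fword]
  | cons a w ih => rw [hfun, wordAppend_cons_zero, wordTail_wordAppend_cons, ih]; rfl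

lemma coding_const_one (hfun : ∀ i, π i = Fmap c (i 0) (π (wordTail i))) :
    π (fun _ => 1) = (1, 0) := by
  have h := hfun (fun _ => 1)
  change π (fun _ => 1) = Fmap c 1 (π (fun _ => 1)) at h
  rw [Fmap_one, Prod.ext_iff] at h
  ext <;> simp at h ⊢ <;> linarith

lemma eq_const_one_of_coding_eq (hc : c ∈ Set.Ioo (0 : ℝ) (1 / 2))
    (hfun : ∀ i, π i = Fmap c (i 0) (π (wordTail i))) (hmem : ∀ i, π i ∈ diamond c)
    {i : ℕ → Fin 3} (h : π i = (1, 0)) : i = fun _ => 1 := by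
  funext n
  induction n generalizing i with
  | zero => exact (of_Fmap_eq_one hc (hmem _) (hfun i ▸ h)).1
  | succ n ih => exact ih (of_Fmap_eq_one hc (hmem _) (hfun i ▸ h)).2

lemma eq_of_coding_eq_zero (hc : c ∈ Set.Ioo (0 : ℝ) (1 / 2))
    (hfun : ∀ i, π i = Fmap c (i 0) (π (wordTail i))) (hmem : ∀ i, π i ∈ diamond c)
    {i : ℕ → Fin 3} (h : π i = (0, 0)) : i = wordAppend [0] (fun _ => 1) := by
  obtain ⟨h0, h1⟩ := of_Fmap_eq_zero hc (hmem _) (hfun i ▸ h)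
  exact eq_wordAppend_cons_iff.2
    ⟨h0, by rw [wordAppend_nil]; exact eq_const_one_of_coding_eq hc hfun hmem h1⟩

lemma exists_of_coding_eq (hc : c ∈ Set.Ioo (0 : ℝ) (1 / 2))
    (hfun : ∀ i, π i = Fmap c (i 0) (π (wordTail i))) (hmem : ∀ i, π i ∈ diamond c)
    {n : ℕ} {i j : ℕ → Fin 3} (hn : i n ≠ j n) (h : π i = π j) :
    ∃ (k : List (Fin 3)) (a b : Fin 3), a ≠ b ∧
      i = wordAppend (k ++ [a, 0]) (fun _ => 1) ∧
      j = wordAppend (k ++ [b, 0]) (fun _ => 1) := by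
  have base {i j : ℕ → Fin 3} (hij : i 0 ≠ j 0) (h : π i = π j) :
      i = wordAppend [i 0, 0] (fun _ => 1) := by
    rw [hfun i, hfun j] at h
    exact eq_wordAppend_cons_iff.2 ⟨rfl, eq_of_coding_eq_zero hc hfun hmem
      (eq_zero_of_Fmap_eq hc hij (hmem _) (hmem _) h)⟩
  induction n generalizing i j with
  | zero => exact ⟨[], i 0, j 0, hn, base hn h, base hn.symm h.symm⟩
  | succ n ih =>
    by_cases h0 : i 0 = j 0
    · rw [hfun i, hfun j, h0] at h
      obtain ⟨k, a, b, hab, hi, hj⟩ :=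
        ih (i := wordTail i) (j := wordTail j) hn (Fmap_injective hc _ h)
      exact ⟨i 0 :: k, a, b, hab, eq_wordAppend_cons_iff.2 ⟨rfl, hi⟩,
        eq_wordAppend_cons_iff.2 ⟨h0.symm, hj⟩⟩
    · exact ⟨[], i 0, j 0, h0, base h0 h, base (Ne.symm h0) h.symm⟩

lemma coding_append_eq (hfun : ∀ i, π i = Fmap c (i 0) (π (wordTail i)))
    (k : List (Fin 3)) (a b : Fin 3) :
    π (wordAppend (k ++ [a, 0]) (fun _ => 1)) = π (wordAppend (k ++ [b, 0]) (fun _ => 1)) := by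
  have hbase (a : Fin 3) : Fmap c a (Fmap c 0 (1, 0)) = (1 / 2, 0) := by
    fin_cases a <;> simp
  induction k with
  | nil =>
    simp only [List.nil_append, coding_wordAppend hfun, coding_const_one hfun, Fword,
      Function.comp_apply, id_eq, hbase]
  | cons d k ih =>
    rw [hfun, hfun (wordAppend (d :: k ++ [b, 0]) _)]
    simp only [List.cons_append, wordAppend_cons_zero, wordTail_wordAppend_cons, ih]

end Coding

/-- For distinct infinite words `i, j`: `π_T(i) = π_T(j)` iff there are a finite word `k`
and distinct letters `a, b` such that `i = k a 1 2 2 2 …` and `j = k b 1 2 2 2 …`.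
Here the letter `1` of `{1,2,3}` is `(0 : Fin 3)` and the letter `2` is `(1 : Fin 3)`. -/
theorem projection_identifications (c : ℝ) (hc : c ∈ Set.Ioo (0 : ℝ) (1 / 2))
    (T : Set (ℝ × ℝ)) (hne : T.Nonempty) (hcomp : IsCompact T)
    (hattr : T = Fmap c 0 '' T ∪ Fmap c 1 '' T ∪ Fmap c 2 '' T)
    (π : (ℕ → Fin 3) → ℝ × ℝ)
    (hπ : ∀ w : List (Fin 3), π '' Set.range (wordAppend w) = Fword c w '' T) :
    ∀ i j : ℕ → Fin 3, i ≠ j →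
      (π i = π j ↔ ∃ (k : List (Fin 3)) (a b : Fin 3), a ≠ b ∧
        i = wordAppend (k ++ [a, 0]) (fun _ => 1) ∧
        j = wordAppend (k ++ [b, 0]) (fun _ => 1)) := by
  have hfun := coding_eq_Fmap hc hcomp.isBounded hπ
  have hmem (i : ℕ → Fin 3) : π i ∈ diamond c := by
    apply subset_of_attractor hc hne hcomp hattr
    have h := Set.mem_image_of_mem π (Set.mem_range_self (f := wordAppend []) i)
    rw [hπ, wordAppend_nil] at h
    simpa [Fword] using h
  intro i j hij
  constructor
  · intro h
    obtain ⟨n, hn⟩ := Function.ne_iff.1 hij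
    exact exists_of_coding_eq hc hfun hmem hn h
  · rintro ⟨k, a, b, -, rfl, rfl⟩
    exact coding_append_eq hfun k a b
end

section
/- For x ∈ T and n ≥ 0 define T_n(x) := ⋃{T_i : i a word of length n with x ∈ T_i}. Then for every x ∈ T: (i) each T_n(x) is a neighbourhood of x in the subspace topology of T ⊆ ℝ², and (ii) for every ε > 0 there exists n such that T_n(x) is contained in the Euclidean ball of radius ε centred at x. In particular, (T_n(x))_{n≥0} is a base of neighbourhoods of x in T. -/
/-- `T_n(x)`: the union of the level-`n` cells `T_w` containing `x`. -/
noncomputable def cellNbhd (c : ℝ) (T : Set (ℝ × ℝ)) (x : ℝ × ℝ) (n : ℕ) : Set (ℝ × ℝ) :=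
  ⋃ (w : List (Fin 3)) (_ : w.length = n ∧ x ∈ Fword c w '' T), Fword c w '' T

theorem lipschitzWith_Fmap {c : ℝ} (hc : c ∈ Set.Ioo (0 : ℝ) (1 / 2)) (a : Fin 3) :
    LipschitzWith (1 / 2) (Fmap c a) := by
  refine LipschitzWith.of_dist_le_mul fun p q => ?_
  obtain ⟨h0, h1⟩ := hc
  have hp : |p.1 - q.1| ≤ dist p q := le_max_left _ _
  have hq : |p.2 - q.2| ≤ dist p q := le_max_right _ _
  generalize dist p q = d at hp hq ⊢
  rw [Prod.dist_eq, Real.dist_eq, Real.dist_eq]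
  rw [abs_le] at hp hq
  push_cast
  refine max_le ?_ ?_ <;> rw [abs_le] <;> unfold Fmap <;> split_ifs <;> dsimp only <;>
    constructor <;> first | linarith | nlinarith

theorem lipschitzWith_Fword {c : ℝ} (hc : c ∈ Set.Ioo (0 : ℝ) (1 / 2)) (w : List (Fin 3)) :
    LipschitzWith ((1 / 2) ^ w.length) (Fword c w) := by
  induction w with
  | nil => simpa [Fword] using LipschitzWith.id
  | cons a w ih =>
    rw [List.length_cons, pow_succ']
    exact (lipschitzWith_Fmap hc a).comp ih

/-- An attractor of the system is covered by its cells of any given level. -/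
theorem exists_mem_cell {c : ℝ} {T : Set (ℝ × ℝ)}
    (hattr : T = Fmap c 0 '' T ∪ Fmap c 1 '' T ∪ Fmap c 2 '' T) (n : ℕ) :
    ∀ y ∈ T, ∃ w : List (Fin 3), w.length = n ∧ y ∈ Fword c w '' T := by
  induction n with
  | zero => exact fun y hy => ⟨[], rfl, y, hy, rfl⟩
  | succ n ih =>
    intro y hy
    have hy' : ∃ a, y ∈ Fmap c a '' T := by
      rw [hattr] at hy
      rcases hy with (hy | hy) | hy
      exacts [⟨0, hy⟩, ⟨1, hy⟩, ⟨2, hy⟩]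
    obtain ⟨a, z, hz, rfl⟩ := hy'
    obtain ⟨w, hw, u, hu, rfl⟩ := ih z hz
    exact ⟨a :: w, by simp [hw], u, hu, rfl⟩

/-- For every `x ∈ T`, each `T_n(x)` is a neighbourhood of `x` in the subspace topology
of `T`, and the `T_n(x)` eventually lie inside any Euclidean ball about `x`; hence they
form a base of neighbourhoods of `x` in `T`. -/
theorem cellNbhd_basis (c : ℝ) (hc : c ∈ Set.Ioo (0 : ℝ) (1 / 2))
    (T : Set (ℝ × ℝ)) (hne : T.Nonempty) (hcomp : IsCompact T)
    (hattr : T = Fmap c 0 '' T ∪ Fmap c 1 '' T ∪ Fmap c 2 '' T) :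
    ∀ x ∈ T,
      (∀ n : ℕ, cellNbhd c T x n ∈ nhdsWithin x T) ∧
      (∀ ε > (0 : ℝ), ∃ n : ℕ, cellNbhd c T x n ⊆
        {y : ℝ × ℝ | Real.sqrt ((y.1 - x.1) ^ 2 + (y.2 - x.2) ^ 2) < ε}) := by
  intro x hx
  refine ⟨fun n => ?_, fun ε hε => ?_⟩
  · let S : Set (List (Fin 3)) := {w | w.length = n ∧ x ∉ Fword c w '' T}
    have hS : S.Finite := (List.finite_length_eq (Fin 3) n).subset fun w hw => hw.1
    have hclosed : IsClosed (⋃ w ∈ S, Fword c w '' T) :=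
      hS.isClosed_biUnion fun w _ => (hcomp.image (lipschitzWith_Fword hc w).continuous).isClosed
    have hxS : x ∉ ⋃ w ∈ S, Fword c w '' T := by
      simp only [Set.mem_iUnion, not_exists]
      exact fun w hw => hw.2
    filter_upwards [self_mem_nhdsWithin,
      mem_nhdsWithin_of_mem_nhds (hclosed.isOpen_compl.mem_nhds hxS)] with y hyT hyS
    obtain ⟨w, hw, hyw⟩ := exists_mem_cell hattr n y hyT
    have hxw : x ∈ Fword c w '' T := by
      by_contra h
      exact hyS (Set.mem_biUnion (show w ∈ S from ⟨hw, h⟩) hyw)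
    exact Set.mem_biUnion (show w.length = n ∧ x ∈ Fword c w '' T from ⟨hw, hxw⟩) hyw
  · obtain ⟨n, hn⟩ := exists_pow_lt_of_lt_one
      (show 0 < ε / (2 * (Metric.diam T + 1)) by have := Metric.diam_nonneg (s := T); positivity)
      (show (1 / 2 : ℝ) < 1 by norm_num)
    refine ⟨n, Set.iUnion₂_subset ?_⟩
    rintro w ⟨rfl, p, hp, rfl⟩ _ ⟨q, hq, rfl⟩
    have hD : 0 ≤ Metric.diam T := Metric.diam_nonneg
    have hlip := (lipschitzWith_Fword hc w).dist_le_mul q p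
    push_cast at hlip
    have hdist : dist (Fword c w q) (Fword c w p) ≤ (1 / 2) ^ w.length * (Metric.diam T + 1) := by
      refine hlip.trans ?_
      gcongr
      linarith [Metric.dist_le_diam_of_mem hcomp.isBounded hq hp]
    rw [lt_div_iff₀ (by positivity)] at hn
    have h1 : |(Fword c w q).1 - (Fword c w p).1| ≤ _ := (le_max_left _ _).trans hdist
    have h2 : |(Fword c w q).2 - (Fword c w p).2| ≤ _ := (le_max_right _ _).trans hdist
    rw [Set.mem_ofPred_eq, Real.sqrt_lt' hε, ← sq_abs (_ - _), ← sq_abs ((Fword c w q).2 - _)]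
    nlinarith [abs_nonneg ((Fword c w q).1 - (Fword c w p).1),
      abs_nonneg ((Fword c w q).2 - (Fword c w p).2)]
end
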